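/- arXiv:1911.10136 — 7 statements merged into one kernel-verified Lean document; each statement's English description precedes it below -/
import Mathlib

section
/- Let a < b be real numbers and let ρ : [a, b] → ℝ be of class C³ with ρ'(u) > 0 for all u ∈ [a, b]. Define D(u) = (b − u)(u − a)/(b − a). Then (1/2) ∫_a^b D(u) (ρ''(u)/ρ'(u))² du + (2/(b − a)) ∫_a^b log ρ'(u) du = −∫_a^b D(u) Sρ(u) du + log(ρ'(a) ρ'(b)). -/
open Real intervalIntegral

/-- The Schwarzian derivative of a real function `h`:
`Sh = (h''/h')' − (1/2)(h''/h')²`. -/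
noncomputable def schwarzianDeriv (h : ℝ → ℝ) (x : ℝ) : ℝ :=
  deriv (fun y => deriv (deriv h) y / deriv h y) x
    - (1 / 2) * (deriv (deriv h) x / deriv h x) ^ 2

/-- Let `f` be positive with logarithmic derivative `q`, let `r` be the derivative of `q`, and let
`D u = (b − u)(u − a)/(b − a)`. The function `D q − (deriv D) log f` is an antiderivative of
`D r + 2/(b − a) log f`, so the integral of the latter over `[a, b]` is the sum of the boundary
values of `log f`. -/
theorem integral_dilation_density_mul_add_log {a b : ℝ} (hab : a < b) {f q r : ℝ → ℝ}
    (hf : ContinuousOn f (Set.Icc a b)) (hq : ContinuousOn q (Set.Icc a b))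
    (hr : ContinuousOn r (Set.Icc a b)) (hpos : ∀ u ∈ Set.Icc a b, 0 < f u)
    (hf' : ∀ u ∈ Set.Ioo a b, HasDerivAt f (q u * f u) u)
    (hq' : ∀ u ∈ Set.Ioo a b, HasDerivAt q (r u) u) :
    ∫ u in a..b, ((b - u) * (u - a) / (b - a) * r u + 2 / (b - a) * Real.log (f u))
      = Real.log (f a * f b) := by
  have hba : b - a ≠ 0 := (sub_pos.2 hab).ne'
  have hlog : ContinuousOn (fun u => Real.log (f u)) (Set.Icc a b) :=
    hf.log fun u hu => (hpos u hu).ne'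
  have key := integral_eq_sub_of_hasDerivAt_of_le hab.le
    (f := fun u => (b - u) * (u - a) / (b - a) * q u
      - (a + b - 2 * u) / (b - a) * Real.log (f u))
    (f' := fun u => (b - u) * (u - a) / (b - a) * r u + 2 / (b - a) * Real.log (f u))
    (by fun_prop) ?_ ?_
  · rw [key, Real.log_mul (hpos a (Set.left_mem_Icc.2 hab.le)).ne'
      (hpos b (Set.right_mem_Icc.2 hab.le)).ne']
    field_simp
    ring
  · intro u hu
    have hfu := (hpos u (Set.Ioo_subset_Icc_self hu)).ne'
    have hid := hasDerivAt_id' u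
    have hD := ((hid.const_sub b).fun_mul (hid.sub_const a)).div_const (b - a)
    have hD' := ((hid.const_mul 2).const_sub (a + b)).div_const (b - a)
    refine ((hD.fun_mul (hq' u hu)).fun_sub (hD'.fun_mul ((hf' u hu).log hfu))).congr_deriv ?_
    field_simp
    ring
  · apply ContinuousOn.intervalIntegrable
    rw [Set.uIcc_of_le hab.le]
    fun_prop

/-- Integration by parts identity on a bounded interval, with
`D(u) = (b − u)(u − a)/(b − a)`:
`(1/2)∫ D (ρ''/ρ')² + (2/(b−a))∫ log ρ' = −∫ D Sρ + log(ρ'(a)ρ'(b))`. -/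
theorem bounded_interval_integration_by_parts (a b : ℝ) (hab : a < b) (ρ : ℝ → ℝ)
    (hρ : ContDiffOn ℝ 3 ρ (Set.Icc a b))
    (hpos : ∀ u ∈ Set.Icc a b, 0 < deriv ρ u) :
    (1 / 2) * (∫ u in a..b,
        ((b - u) * (u - a) / (b - a)) * (deriv (deriv ρ) u / deriv ρ u) ^ 2)
      + (2 / (b - a)) * ∫ u in a..b, Real.log (deriv ρ u)
    = -(∫ u in a..b, ((b - u) * (u - a) / (b - a)) * schwarzianDeriv ρ u)
      + Real.log (deriv ρ a * deriv ρ b) := by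
  set I := Set.Icc a b
  have huniq : UniqueDiffOn ℝ I := uniqueDiffOn_Icc hab
  set f := derivWithin ρ I
  set g := derivWithin f I
  set q : ℝ → ℝ := fun u => g u / f u with hq_def
  set r := derivWithin q I
  have hρf : ∀ u ∈ I, deriv ρ u = f u := fun u hu =>
    ((differentiableAt_of_deriv_ne_zero (hpos u hu).ne').derivWithin (huniq u hu)).symm
  have hfpos : ∀ u ∈ I, 0 < f u := fun u hu => hρf u hu ▸ hpos u hu
  have hf : ContDiffOn ℝ 2 f I := hρ.derivWithin huniq (by norm_num)
  have hg : ContDiffOn ℝ 1 g I := hf.derivWithin huniq (by norm_num)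
  have hq : ContDiffOn ℝ 1 q I := hg.div (hf.of_le (by norm_num)) fun u hu => (hfpos u hu).ne'
  have hr : ContinuousOn r I := hq.continuousOn_derivWithin huniq le_rfl
  have hasDeriv : ∀ {h : ℝ → ℝ}, DifferentiableOn ℝ h I → ∀ u ∈ Set.Ioo a b,
      HasDerivAt h (derivWithin h I u) u := fun hh u hu =>
    (hh u (Set.Ioo_subset_Icc_self hu)).hasDerivWithinAt.hasDerivAt (Icc_mem_nhds hu.1 hu.2)
  have hf' := hasDeriv (hf.differentiableOn (by norm_num))
  have hq' := hasDeriv (hq.differentiableOn (by norm_num))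
  have hdd : ∀ u ∈ Set.Ioo a b, deriv (deriv ρ) u = g u := fun u hu =>
    ((hf' u hu).congr_of_eventuallyEq (Filter.eventuallyEq_of_mem
      (Icc_mem_nhds hu.1 hu.2) hρf)).deriv
  have hquot : Set.EqOn (fun y => deriv (deriv ρ) y / deriv ρ y) q (Set.Ioo a b) := fun u hu => by
    simp only [hq_def, hdd u hu, hρf u (Set.Ioo_subset_Icc_self hu)]
  have hS : ∀ u ∈ Set.Ioo a b, schwarzianDeriv ρ u = r u - (1 / 2) * q u ^ 2 := fun u hu => by
    rw [schwarzianDeriv, ((hq' u hu).congr_of_eventuallyEq (Filter.eventuallyEq_of_mem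
      (Ioo_mem_nhds hu.1 hu.2) hquot)).deriv]
    exact congrArg (fun t => r u - (1 / 2) * t ^ 2) (hquot hu)
  have hint : ∀ {h : ℝ → ℝ}, ContinuousOn h I → IntervalIntegrable h MeasureTheory.volume a b :=
    fun hh => ContinuousOn.intervalIntegrable (by rwa [Set.uIcc_of_le hab.le])
  have hfc := hf.continuousOn
  have hqc := hq.continuousOn
  have key := integral_dilation_density_mul_add_log hab hfc hqc hr hfpos
    (fun u hu => by
      simpa only [hq_def, div_mul_cancel₀ _ (hfpos u (Set.Ioo_subset_Icc_self hu)).ne']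
        using hf' u hu) hq'
  have hlog : ContinuousOn (fun u => Real.log (f u)) I := hfc.log fun u hu => (hfpos u hu).ne'
  have e1 : ∫ u in a..b, ((b - u) * (u - a) / (b - a)) * (deriv (deriv ρ) u / deriv ρ u) ^ 2
      = ∫ u in a..b, ((b - u) * (u - a) / (b - a)) * q u ^ 2 :=
    integral_congr_Ioo_of_le hab.le fun u hu =>
      congrArg (fun t => (b - u) * (u - a) / (b - a) * t ^ 2) (hquot hu)
  have e2 : ∫ u in a..b, Real.log (deriv ρ u) = ∫ u in a..b, Real.log (f u) :=
    integral_congr_Ioo_of_le hab.le fun u hu =>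
      congrArg Real.log (hρf u (Set.Ioo_subset_Icc_self hu))
  have e3 : ∫ u in a..b, ((b - u) * (u - a) / (b - a)) * schwarzianDeriv ρ u
      = (∫ u in a..b, ((b - u) * (u - a) / (b - a)) * r u)
        - (1 / 2) * ∫ u in a..b, ((b - u) * (u - a) / (b - a)) * q u ^ 2 := by
    rw [← integral_const_mul, ← integral_sub (hint (by fun_prop)) (hint (by fun_prop))]
    refine integral_congr_Ioo_of_le hab.le fun u hu => ?_
    simp only [hS u hu]
    ring
  rw [integral_add (hint (by fun_prop)) (hint (by fun_prop)), integral_const_mul] at key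
  rw [e1, e2, e3, hρf a (Set.left_mem_Icc.2 hab.le), hρf b (Set.right_mem_Icc.2 hab.le), ← key]
  ring
end

section
/- Let c > 0 and let ρ : ℝ → ℝ be a C² bijection with ρ'(u) > 0 for all u, such that ∫_t^∞ (ρ''(u)/ρ'(u))² du and ∫_t^∞ (u − t)(ρ''(u)/ρ'(u))² du are finite for every t. Define S_ρ(t) = (c/24) ∫_{ρ^{-1}(t)}^∞ (u − ρ^{-1}(t)) (ρ''(u)/ρ'(u))² du. Then for every t ∈ ℝ: (i) S_ρ'(ρ(t)) ρ'(t) = −(c/24) ∫_t^∞ (ρ''(u)/ρ'(u))² du, so S_ρ is decreasing; and (ii) S_ρ''(ρ(t)) ρ'(t)² = (c/24) (ρ''(t)/ρ'(t)) · [ (ρ''(t)/ρ'(t)) + ∫_t^∞ (ρ''(u)/ρ'(u))² du ]. -/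
open Real MeasureTheory

/-- The exchanged relative entropy
`S_ρ(t) = (c/24) ∫_{ρ⁻¹(t)}^∞ (u − ρ⁻¹(t)) (ρ''(u)/ρ'(u))² du`. -/
noncomputable def Srho (c : ℝ) (ρ : ℝ → ℝ) (t : ℝ) : ℝ :=
  (c / 24) * ∫ u in Set.Ioi (Function.invFun ρ t),
    (u - Function.invFun ρ t) * (deriv (deriv ρ) u / deriv ρ u) ^ 2

theorem hasDerivAt_integral_Ioi {h : ℝ → ℝ} (hc : Continuous h)
    (hi : ∀ t : ℝ, IntegrableOn h (Set.Ioi t)) (t : ℝ) :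
    HasDerivAt (fun s => ∫ u in Set.Ioi s, h u) (-h t) t := by
  have key : (fun s => ∫ u in Set.Ioi s, h u)
      = fun s => (∫ u in Set.Ioi 0, h u) - ∫ u in (0 : ℝ)..s, h u := by
    funext s
    rw [← intervalIntegral.integral_Ioi_sub_Ioi' (hi 0) (hi s)]
    ring
  rw [key]
  exact (intervalIntegral.integral_hasDerivAt_right (hc.intervalIntegrable _ _)
    hc.stronglyMeasurable.stronglyMeasurableAtFilter hc.continuousAt).const_sub _

theorem hasDerivAt_integral_Ioi_sub_mul {g : ℝ → ℝ} (hc : Continuous g)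
    (hi : ∀ t : ℝ, IntegrableOn g (Set.Ioi t))
    (hi' : ∀ t : ℝ, IntegrableOn (fun u => (u - t) * g u) (Set.Ioi t)) (t : ℝ) :
    HasDerivAt (fun s => ∫ u in Set.Ioi s, (u - s) * g u) (-∫ u in Set.Ioi t, g u) t := by
  have hmul : ∀ s : ℝ, IntegrableOn (fun u => u * g u) (Set.Ioi s) := fun s => by
    refine ((hi' s).add ((hi s).const_mul s)).congr (.of_forall fun u => ?_)
    simp only [Pi.add_apply]
    ring
  have key : (fun s => ∫ u in Set.Ioi s, (u - s) * g u)
      = fun s => (∫ u in Set.Ioi s, u * g u) - s * ∫ u in Set.Ioi s, g u := by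
    funext s
    rw [← integral_const_mul, ← integral_sub (hmul s) ((hi s).const_mul s)]
    simp only [sub_mul]
  rw [key]
  refine ((hasDerivAt_integral_Ioi (continuous_id.mul hc) hmul t).sub
    ((hasDerivAt_id t).mul (hasDerivAt_integral_Ioi hc hi t))).congr_deriv ?_
  simp only [Pi.mul_apply, id]
  ring

theorem StrictMono.continuous_invFun {f : ℝ → ℝ} (hf : StrictMono f)
    (hs : Function.Surjective f) : Continuous (Function.invFun f) := by
  have h : Function.invFun f = (hf.orderIsoOfSurjective f hs).symm := by
    funext s
    apply hf.injective
    rw [Function.invFun_eq (hs s)]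
    exact ((hf.orderIsoOfSurjective f hs).apply_symm_apply s).symm
  rw [h]
  exact (hf.orderIsoOfSurjective f hs).symm.continuous

/-- Derivative formulas for the exchanged relative entropy:
`S_ρ'(ρ(t))ρ'(t) = −(c/24)∫_t^∞ (ρ''/ρ')²` (so `S_ρ` is decreasing) and
`S_ρ''(ρ(t))ρ'(t)² = (c/24)(ρ''(t)/ρ'(t))[(ρ''(t)/ρ'(t)) + ∫_t^∞ (ρ''/ρ')²]`. -/
theorem Srho_deriv_formulas (c : ℝ) (hc : 0 < c) (ρ : ℝ → ℝ)
    (hbij : Function.Bijective ρ) (hρ : ContDiff ℝ 2 ρ)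
    (hpos : ∀ u, 0 < deriv ρ u)
    (hint1 : ∀ t : ℝ,
      IntegrableOn (fun u => (deriv (deriv ρ) u / deriv ρ u) ^ 2) (Set.Ioi t))
    (hint2 : ∀ t : ℝ,
      IntegrableOn (fun u => (u - t) * (deriv (deriv ρ) u / deriv ρ u) ^ 2) (Set.Ioi t)) :
    (∀ t : ℝ, deriv (Srho c ρ) (ρ t) * deriv ρ t
        = -(c / 24) * ∫ u in Set.Ioi t, (deriv (deriv ρ) u / deriv ρ u) ^ 2)
    ∧ Antitone (Srho c ρ)
    ∧ (∀ t : ℝ, deriv (deriv (Srho c ρ)) (ρ t) * (deriv ρ t) ^ 2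
        = (c / 24) * (deriv (deriv ρ) t / deriv ρ t)
          * ((deriv (deriv ρ) t / deriv ρ t)
            + ∫ u in Set.Ioi t, (deriv (deriv ρ) u / deriv ρ u) ^ 2)) := by
  have hd1 : ContDiff ℝ 1 (deriv ρ) :=
    (contDiff_succ_iff_deriv (n := 1).1 (by simpa [one_add_one_eq_two] using hρ)).2.2
  have hd2 : Continuous (deriv (deriv ρ)) := hd1.continuous_deriv le_rfl
  have hρ' : ∀ u, HasDerivAt ρ (deriv ρ u) u := fun u =>
    (hρ.differentiable (by norm_num) u).hasDerivAt
  have hρ'' : ∀ u, HasDerivAt (deriv ρ) (deriv (deriv ρ) u) u := fun u =>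
    (hd1.differentiable (by norm_num) u).hasDerivAt
  have hg : Continuous fun u => (deriv (deriv ρ) u / deriv ρ u) ^ 2 :=
    (hd2.div hd1.continuous fun u => (hpos u).ne').pow 2
  have hmono : StrictMono ρ := strictMono_of_deriv_pos hpos
  have hinv : ∀ s, ρ (Function.invFun ρ s) = s := fun s =>
    Function.invFun_eq (hbij.surjective s)
  have hleft : ∀ t, Function.invFun ρ (ρ t) = t := Function.leftInverse_invFun hbij.injective
  have hσ : ∀ s, HasDerivAt (Function.invFun ρ) (deriv ρ (Function.invFun ρ s))⁻¹ s := fun s =>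
    (hρ' _).of_local_left_inverse
      (hmono.continuous_invFun hbij.surjective).continuousAt (hpos _).ne' (.of_forall hinv)
  have hS : ∀ s, HasDerivAt (Srho c ρ)
      (-(c / 24) * ((∫ u in Set.Ioi (Function.invFun ρ s), (deriv (deriv ρ) u / deriv ρ u) ^ 2)
        / deriv ρ (Function.invFun ρ s))) s := fun s => by
    refine (((hasDerivAt_integral_Ioi_sub_mul hg hint1 hint2 _).comp s (hσ s)).const_mul
      (c / 24)).congr_deriv ?_
    ring
  refine ⟨fun t => ?_, ?_, fun t => ?_⟩
  · have := (hpos t).ne'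
    rw [(hS _).deriv, hleft]
    field_simp
  · refine antitone_of_deriv_nonpos (fun s => (hS s).differentiableAt) fun s => ?_
    rw [(hS s).deriv, neg_mul, neg_nonpos]
    exact mul_nonneg (by positivity)
      (div_nonneg (integral_nonneg fun u => sq_nonneg _) (hpos _).le)
  · have hne := (hpos t).ne'
    have hS' := ((((hasDerivAt_integral_Ioi hg hint1 _).div (hρ'' _) (hpos _).ne').comp (ρ t)
      (hσ (ρ t))).const_mul (-(c / 24))).deriv
    rw [funext fun s => (hS s).deriv]
    refine (congrArg (· * deriv ρ t ^ 2) hS').trans ?_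
    simp only [hleft]
    field_simp
    ring
end

section
/- Let c > 0, let a < b, and let ρ : ℝ → ℝ be a C² bijection with ρ'(u) > 0 for all u and ρ(u) = u for all u ∉ [a, b]. Define S_ρ(t) = (c/24) ∫_{ρ^{-1}(t)}^∞ (u − ρ^{-1}(t)) (ρ''(u)/ρ'(u))² du. Then ∫_a^b S_ρ''(t) dt = (c/24) ∫_a^b (ρ''(t)/ρ'(t))² dt ≥ 0, i.e. S_ρ is convex in the average over [a, b]. -/
open Real MeasureTheory intervalIntegral

/-- An integral over `(x, ∞)` of a function vanishing on `(b, ∞)` is an interval integral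
from `x` to `b`, whatever the order of `x` and `b`. -/
theorem setIntegral_Ioi_eq_intervalIntegral_of_eq_zero {h : ℝ → ℝ} {b : ℝ}
    (hz : ∀ u, b < u → h u = 0) (x : ℝ) :
    ∫ u in Set.Ioi x, h u = ∫ u in x..b, h u := by
  rcases le_total x b with hxb | hbx
  · rw [intervalIntegral.integral_of_le hxb]
    refine setIntegral_eq_of_subset_of_forall_sdiff_eq_zero measurableSet_Ioi
      Set.Ioc_subset_Ioi_self fun u hu => hz u ?_
    by_contra! hub
    exact hu.2 ⟨hu.1, hub⟩
  · have hIoi : ∫ u in Set.Ioi x, h u = 0 :=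
      setIntegral_eq_zero_of_forall_eq_zero fun u hu => hz u (hbx.trans_lt hu)
    have hIoc : ∫ u in Set.Ioc b x, h u = 0 :=
      setIntegral_eq_zero_of_forall_eq_zero fun u hu => hz u hu.1
    rw [hIoi, intervalIntegral.integral_symm, intervalIntegral.integral_of_le hbx, hIoc, neg_zero]

theorem hasDerivAt_integral_left {f : ℝ → ℝ} (hf : Continuous f) (b x : ℝ) :
    HasDerivAt (fun y => ∫ u in y..b, f u) (-f x) x :=
  intervalIntegral.integral_hasDerivAt_left (hf.intervalIntegrable _ _)
    (hf.stronglyMeasurableAtFilter _ _) hf.continuousAt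

theorem hasDerivAt_integral_sub_mul {f : ℝ → ℝ} (hf : Continuous f) (b x : ℝ) :
    HasDerivAt (fun y => ∫ u in y..b, (u - y) * f u) (-∫ u in x..b, f u) x := by
  have hsplit : (fun y => ∫ u in y..b, (u - y) * f u) =
      fun y => (∫ u in y..b, u * f u) - y * ∫ u in y..b, f u := by
    funext y
    have hid_mul : Continuous fun u => u * f u := by fun_prop
    have hconst_mul : Continuous fun u => y * f u := by fun_prop
    rw [← intervalIntegral.integral_const_mul, ← intervalIntegral.integral_sub
      (hid_mul.intervalIntegrable _ _) (hconst_mul.intervalIntegrable _ _)]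
    simp only [sub_mul]
  rw [hsplit]
  have hid_mul : Continuous fun u => u * f u := by fun_prop
  exact ((hasDerivAt_integral_left hid_mul b x).sub
    ((hasDerivAt_id' x).mul (hasDerivAt_integral_left hf b x))).congr_deriv (by ring)

/-- The inverse of a bijection with everywhere positive derivative is differentiable. -/
theorem hasDerivAt_invFun_of_deriv_pos {ρ : ℝ → ℝ} (hbij : Function.Bijective ρ)
    (hpos : ∀ u, 0 < deriv ρ u) (t : ℝ) :
    HasDerivAt (Function.invFun ρ) (deriv ρ (Function.invFun ρ t))⁻¹ t := by
  have hright := Function.rightInverse_invFun hbij.2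
  let e := (strictMono_of_deriv_pos hpos).orderIsoOfSurjective ρ hbij.2
  have he : Function.invFun ρ = e.symm := by
    funext s
    apply hbij.1
    rw [hright s]
    exact (e.apply_symm_apply s).symm
  have hcont : Continuous (Function.invFun ρ) := he ▸ e.symm.continuous
  exact HasDerivAt.of_local_left_inverse hcont.continuousAt
    (differentiableAt_of_deriv_ne_zero (hpos _).ne').hasDerivAt (hpos _).ne'
    (Filter.Eventually.of_forall hright)

/-- Convexity in the average: if `ρ` is the identity outside `[a, b]`, then
`∫_a^b S_ρ''(t) dt = (c/24) ∫_a^b (ρ''(t)/ρ'(t))² dt ≥ 0`. -/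
theorem Srho_average_convex (c : ℝ) (hc : 0 < c) (a b : ℝ) (hab : a < b)
    (ρ : ℝ → ℝ) (hbij : Function.Bijective ρ) (hρ : ContDiff ℝ 2 ρ)
    (hpos : ∀ u, 0 < deriv ρ u)
    (hid : ∀ u, u ∉ Set.Icc a b → ρ u = u) :
    (∫ t in a..b, deriv (deriv (Srho c ρ)) t
        = (c / 24) * ∫ t in a..b, (deriv (deriv ρ) t / deriv ρ t) ^ 2)
    ∧ 0 ≤ (c / 24) * ∫ t in a..b, (deriv (deriv ρ) t / deriv ρ t) ^ 2 := by
  refine ⟨?_, mul_nonneg (by positivity)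
    (intervalIntegral.integral_nonneg hab.le fun u _ => sq_nonneg _)⟩
  have hρ' : ContDiff ℝ 1 (deriv ρ) := ((contDiff_succ_iff_deriv (n := 1)).1 hρ).2.2
  set f : ℝ → ℝ := fun u => (deriv (deriv ρ) u / deriv ρ u) ^ 2 with hf_def
  have hf : Continuous f :=
    ((hρ'.continuous_deriv le_rfl).div hρ'.continuous fun u => (hpos u).ne').pow 2
  have hderiv_one : ∀ u, u ∉ Set.Icc a b → deriv ρ u = 1 := fun u hu => by
    have : ρ =ᶠ[nhds u] id := by
      filter_upwards [isClosed_Icc.isOpen_compl.mem_nhds hu] with v hv using hid v hv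
    rw [this.deriv_eq, deriv_id]
  have hf_zero : ∀ u, b < u → f u = 0 := fun u hu => by
    have : deriv ρ =ᶠ[nhds u] fun _ => 1 := by
      filter_upwards [lt_mem_nhds hu] with v hv
      exact hderiv_one v fun h => (h.2.trans_lt hv).false
    simp [hf_def, this.deriv_eq]
  have hρa : ρ a = a := by
    have h : Set.EqOn ρ id (Set.Iio a) := fun v hv => hid v fun h => (h.1.trans_lt hv).false
    exact h.closure hρ.continuous continuous_id (by simp)
  have hderiv_a : deriv ρ a = 1 := by
    have h : Set.EqOn (deriv ρ) (fun _ => 1) (Set.Iio a) :=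
      fun v hv => hderiv_one v fun h => (h.1.trans_lt hv).false
    exact h.closure hρ'.continuous continuous_const (by simp)
  have hρb : ρ b = b := by
    have h : Set.EqOn ρ id (Set.Ioi b) := fun v hv => hid v fun h => (h.2.trans_lt hv).false
    exact h.closure hρ.continuous continuous_id (by simp)
  set g := Function.invFun ρ with hg_def
  have hleft : Function.LeftInverse g ρ := Function.leftInverse_invFun hbij.1
  have hga : g a = a := by simpa [hρa] using hleft a
  have hgb : g b = b := by simpa [hρb] using hleft b
  have hg : ∀ t, HasDerivAt g (deriv ρ (g t))⁻¹ t := hasDerivAt_invFun_of_deriv_pos hbij hpos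
  have hg_diff : Differentiable ℝ g := fun t => (hg t).differentiableAt
  have hg_contDiff : ContDiff ℝ 1 g := by
    refine contDiff_one_iff_deriv.2 ⟨hg_diff, ?_⟩
    rw [deriv_eq hg]
    exact (hρ'.continuous.comp hg_diff.continuous).inv₀ fun t => (hpos _).ne'
  have hF_contDiff : ContDiff ℝ 1 (fun y => ∫ u in y..b, f u) := by
    refine contDiff_one_iff_deriv.2
      ⟨fun x => (hasDerivAt_integral_left hf b x).differentiableAt, ?_⟩
    rw [deriv_eq (hasDerivAt_integral_left hf b)]
    exact hf.neg
  have hS : Srho c ρ = fun t => (c / 24) * ∫ u in (g t)..b, (u - g t) * f u := by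
    funext t
    rw [Srho, ← setIntegral_Ioi_eq_intervalIntegral_of_eq_zero
      fun u hu => by rw [hf_zero u hu, mul_zero]]
  have hS' : deriv (Srho c ρ) =
      fun t => (c / 24) * ((-∫ u in (g t)..b, f u) * (deriv ρ (g t))⁻¹) := by
    rw [hS]
    exact deriv_eq fun t =>
      ((hasDerivAt_integral_sub_mul hf b (g t)).comp t (hg t)).const_mul (c / 24)
  have hS'_contDiff : ContDiff ℝ 1 (deriv (Srho c ρ)) := by
    rw [hS']
    exact contDiff_const.mul ((hF_contDiff.comp hg_contDiff).neg.mul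
      ((hρ'.comp hg_contDiff).inv fun t => (hpos _).ne'))
  rw [intervalIntegral.integral_deriv_eq_sub
    (fun t _ => (hS'_contDiff.differentiable one_ne_zero) t)
    ((hS'_contDiff.continuous_deriv le_rfl).intervalIntegrable _ _), hS']
  simp [hga, hgb, hderiv_a, hf_def]
end

section
/- Let ρ(u) = arctan(tan(u) + 1) for u ∈ (0, π/2). Then ∫_0^{π/2} (ρ''(u)/ρ'(u))² du > 1. Consequently, since ρ''(0)/ρ'(0) = −1, the quantity (ρ''(0)/ρ'(0)) · [ (ρ''(0)/ρ'(0)) + ∫_0^{π/2} (ρ''(u)/ρ'(u))² du ] is strictly negative. -/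
open Real intervalIntegral

/-- `ρ(u) = arctan(tan u + 1)`, the time-one flow of `f(x) = 1/(1 + tan² x)`. -/
noncomputable def rhoFlow : ℝ → ℝ := fun u => Real.arctan (Real.tan u + 1)

lemma rhoFlow_denom_pos (u : ℝ) : 0 < (sin u + cos u) ^ 2 + cos u ^ 2 := by
  nlinarith [sq_nonneg (sin u + cos u), sq_nonneg (cos u), sq_nonneg (sin u + 2 * cos u),
    sin_sq_add_cos_sq u]

lemma hasDerivAt_rhoFlow {u : ℝ} (hu : cos u ≠ 0) :
    HasDerivAt rhoFlow ((sin u + cos u) ^ 2 + cos u ^ 2)⁻¹ u := by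
  have hD := (rhoFlow_denom_pos u).ne'
  have hw : 1 + (tan u + 1) ^ 2 ≠ 0 := by positivity
  refine ((hasDerivAt_tan hu).add_const 1).arctan.congr_deriv ?_
  have key : (sin u + cos u) ^ 2 + cos u ^ 2 = (1 + (tan u + 1) ^ 2) * cos u ^ 2 := by
    rw [tan_eq_sin_div_cos]
    field_simp
    ring
  rw [key]
  field_simp

lemma hasDerivAt_rhoFlow_denom (u : ℝ) :
    HasDerivAt (fun x => (sin x + cos x) ^ 2 + cos x ^ 2)
      (2 * (cos u ^ 2 - sin u * cos u - sin u ^ 2)) u := by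
  refine ((((hasDerivAt_sin u).add (hasDerivAt_cos u)).pow 2).add
    ((hasDerivAt_cos u).pow 2)).congr_deriv ?_
  simp
  ring

lemma deriv_deriv_rhoFlow_div_deriv {u : ℝ} (hu : cos u ≠ 0) :
    deriv (deriv rhoFlow) u / deriv rhoFlow u
      = 2 * (sin u ^ 2 + sin u * cos u - cos u ^ 2) / ((sin u + cos u) ^ 2 + cos u ^ 2) := by
  have hD := (rhoFlow_denom_pos u).ne'
  have hev : deriv rhoFlow =ᶠ[nhds u] fun x => ((sin x + cos x) ^ 2 + cos x ^ 2)⁻¹ := by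
    filter_upwards [continuous_cos.continuousAt.eventually_ne hu] with x hx
    exact (hasDerivAt_rhoFlow hx).deriv
  rw [hev.deriv_eq, ((hasDerivAt_rhoFlow_denom u).fun_inv hD).deriv, (hasDerivAt_rhoFlow hu).deriv]
  field_simp
  ring

lemma hasDerivAt_primitive {u : ℝ} (hu : cos u ≠ 0) :
    HasDerivAt (fun x => 6 * rhoFlow x - 4 * x
        - (2 * sin x * cos x + 6 * cos x ^ 2) / ((sin x + cos x) ^ 2 + cos x ^ 2))
      ((2 * (sin u ^ 2 + sin u * cos u - cos u ^ 2)
        / ((sin u + cos u) ^ 2 + cos u ^ 2)) ^ 2) u := by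
  have hD := (rhoFlow_denom_pos u).ne'
  have hN : HasDerivAt (fun x => 2 * sin x * cos x + 6 * cos x ^ 2)
      (2 * cos u ^ 2 - 2 * sin u ^ 2 - 12 * sin u * cos u) u := by
    refine ((((hasDerivAt_sin u).const_mul 2).mul (hasDerivAt_cos u)).add
      (((hasDerivAt_cos u).pow 2).const_mul 6)).congr_deriv ?_
    simp
    ring
  refine ((((hasDerivAt_rhoFlow hu).const_mul 6).sub ((hasDerivAt_id u).const_mul 4)).sub
    (hN.div (hasDerivAt_rhoFlow_denom u) hD)).congr_deriv ?_
  have h1 := sin_sq_add_cos_sq u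
  generalize sin u = s at *
  generalize cos u = c at *
  field_simp
  linear_combination (-6 * ((s + c) ^ 2 + c ^ 2)) * h1

lemma tendsto_rhoFlow_pi_div_two :
    Filter.Tendsto rhoFlow (nhdsWithin (π / 2) (Set.Iio (π / 2))) (nhds (π / 2)) :=
  (tendsto_arctan_atTop.mono_right nhdsWithin_le_nhds).comp
    (Filter.tendsto_atTop_add_const_right _ 1 tendsto_tan_pi_div_two)

lemma integral_sq_deriv_deriv_rhoFlow_div_deriv :
    ∫ u in (0:ℝ)..(π / 2), (deriv (deriv rhoFlow) u / deriv rhoFlow u) ^ 2 = 3 - π / 2 := by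
  have hcos : ∀ u ∈ Set.Ioo 0 (π / 2), cos u ≠ 0 := fun u hu =>
    (cos_pos_of_mem_Ioo ⟨by linarith [hu.1, pi_pos], hu.2⟩).ne'
  have hcongr : ∫ u in (0:ℝ)..(π / 2), (deriv (deriv rhoFlow) u / deriv rhoFlow u) ^ 2
      = ∫ u in (0:ℝ)..(π / 2), (2 * (sin u ^ 2 + sin u * cos u - cos u ^ 2)
        / ((sin u + cos u) ^ 2 + cos u ^ 2)) ^ 2 := by
    rw [integral_of_le (by positivity), integral_of_le (by positivity),
      MeasureTheory.integral_Ioc_eq_integral_Ioo, MeasureTheory.integral_Ioc_eq_integral_Ioo]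
    refine MeasureTheory.setIntegral_congr_fun measurableSet_Ioo fun u hu => ?_
    simp only [deriv_deriv_rhoFlow_div_deriv (hcos u hu)]
  have hcont : Continuous fun u : ℝ => (2 * (sin u ^ 2 + sin u * cos u - cos u ^ 2)
      / ((sin u + cos u) ^ 2 + cos u ^ 2)) ^ 2 :=
    (Continuous.div (by fun_prop) (by fun_prop) fun u => (rhoFlow_denom_pos u).ne').pow 2
  have hquot : Continuous fun x : ℝ =>
      (2 * sin x * cos x + 6 * cos x ^ 2) / ((sin x + cos x) ^ 2 + cos x ^ 2) :=
    Continuous.div (by fun_prop) (by fun_prop) fun u => (rhoFlow_denom_pos u).ne'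
  have hleft := (hasDerivAt_primitive (u := 0) (by simp)).continuousAt.tendsto.mono_left
    (nhdsWithin_le_nhds (s := Set.Ioi 0))
  have hright := ((tendsto_rhoFlow_pi_div_two.const_mul 6).sub
    ((continuous_const_mul (4 : ℝ)).continuousAt.tendsto.mono_left nhdsWithin_le_nhds)).sub
    ((hquot.tendsto (π / 2)).mono_left nhdsWithin_le_nhds)
  rw [hcongr, integral_eq_sub_of_hasDerivAt_of_tendsto (by positivity)
    (fun u hu => hasDerivAt_primitive (hcos u hu)) (hcont.intervalIntegrable _ _) hleft hright]
  simp [rhoFlow]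
  ring

/-- `∫_0^{π/2} (ρ''/ρ')² du > 1`, and consequently (since `ρ''(0)/ρ'(0) = −1`)
the quantity `(ρ''(0)/ρ'(0))·[(ρ''(0)/ρ'(0)) + ∫_0^{π/2} (ρ''/ρ')² du]` is
strictly negative: the counterexample to pointwise convexity. -/
theorem counterexample_second_derivative :
    (1 < ∫ u in (0:ℝ)..(π / 2),
        (deriv (deriv rhoFlow) u / deriv rhoFlow u) ^ 2)
    ∧ (deriv (deriv rhoFlow) 0 / deriv rhoFlow 0)
        * ((deriv (deriv rhoFlow) 0 / deriv rhoFlow 0)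
          + ∫ u in (0:ℝ)..(π / 2),
              (deriv (deriv rhoFlow) u / deriv rhoFlow u) ^ 2) < 0 := by
  have h0 : deriv (deriv rhoFlow) 0 / deriv rhoFlow 0 = -1 := by
    rw [deriv_deriv_rhoFlow_div_deriv (by simp)]
    norm_num
  rw [h0, integral_sq_deriv_deriv_rhoFlow_div_deriv]
  constructor <;> linarith [pi_lt_four]
end

section
/- Let f₁, f₂ : ℝ → ℝ be C¹ functions with compact disjoint supports, and set f = f₁ + f₂. Let ρ, ρ¹, ρ² : ℝ × ℝ → ℝ satisfy ∂_t ρ_t(u) = f(ρ_t(u)), ∂_t ρ¹_t(u) = f₁(ρ¹_t(u)), ∂_t ρ²_t(u) = f₂(ρ²_t(u)) with ρ_0 = ρ¹_0 = ρ²_0 = id. Then ρ_t = ρ¹_t ∘ ρ²_t = ρ²_t ∘ ρ¹_t for all t ∈ ℝ. -/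
open Real

/-- An integral curve of a Lipschitz vector field that meets a zero of the field is constant. -/
theorem LipschitzWith.eq_of_hasDerivAt_of_apply_eq_zero {E : Type*} [NormedAddCommGroup E]
    [NormedSpace ℝ E] {f : E → E} {K : NNReal} (hf : LipschitzWith K f) {x : ℝ → E}
    (hx : ∀ t, HasDerivAt x (f (x t)) t) {s : ℝ} (hs : f (x s) = 0) (t : ℝ) : x t = x s := by
  have h : x = fun _ => x s :=
    ODE_solution_unique_univ (v := fun _ => f) (s := fun _ => Set.univ) (t₀ := s)
      (fun _ => hf.lipschitzOnWith) (fun r => ⟨hx r, trivial⟩)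
      (fun r => ⟨by simpa [hs] using hasDerivAt_const r (x s), trivial⟩) rfl
  exact congrFun h t

/-- At a zero of `f₂`, the flows of `f₁ + f₂` and `f₁` agree, and the flow of `f₂` is trivial both
at that point and along the trajectory of `f₁` through it. -/
theorem flow_eq_of_apply_eq_zero {E : Type*} [NormedAddCommGroup E] [NormedSpace ℝ E]
    {f₁ f₂ : E → E} {K₁ K₂ : NNReal} (hf₁ : LipschitzWith K₁ f₁) (hf₂ : LipschitzWith K₂ f₂)
    (hzero : ∀ x, f₁ x = 0 ∨ f₂ x = 0) {ρ ρ₁ ρ₂ : ℝ → E → E}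
    (h0 : ∀ u, ρ 0 u = u) (h01 : ∀ u, ρ₁ 0 u = u) (h02 : ∀ u, ρ₂ 0 u = u)
    (hflow : ∀ t u, HasDerivAt (fun s => ρ s u) (f₁ (ρ t u) + f₂ (ρ t u)) t)
    (hflow1 : ∀ t u, HasDerivAt (fun s => ρ₁ s u) (f₁ (ρ₁ t u)) t)
    (hflow2 : ∀ t u, HasDerivAt (fun s => ρ₂ s u) (f₂ (ρ₂ t u)) t)
    {u : E} (hu : f₂ u = 0) (t : ℝ) :
    ρ t u = ρ₁ t (ρ₂ t u) ∧ ρ t u = ρ₂ t (ρ₁ t u) := by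
  have fixed (v : E) (hv : f₂ v = 0) : ρ₂ t v = v := by
    have := hf₂.eq_of_hasDerivAt_of_apply_eq_zero (fun r => hflow2 r v) (s := 0)
      (by rwa [h02]) t
    rwa [h02] at this
  have vanish (r : ℝ) : f₂ (ρ₁ r u) = 0 := by
    refine (hzero (ρ₁ r u)).elim (fun h => ?_) id
    have := hf₁.eq_of_hasDerivAt_of_apply_eq_zero (fun r => hflow1 r u) h 0
    rwa [← this, h01]
  have agree : (fun r => ρ r u) = fun r => ρ₁ r u :=
    ODE_solution_unique_univ (v := fun _ x => f₁ x + f₂ x) (s := fun _ => Set.univ) (t₀ := 0)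
      (fun _ => (hf₁.add hf₂).lipschitzOnWith) (fun r => ⟨hflow r u, trivial⟩)
      (fun r => ⟨by simpa [vanish r] using hflow1 r u, trivial⟩) (by simp [h0, h01])
  rw [fixed u hu, fixed _ (vanish t)]
  exact ⟨congrFun agree t, congrFun agree t⟩

/-- Factorization of flows: if `f₁, f₂` are C¹ with compact disjoint supports and
`ρ, ρ¹, ρ²` are the flows of `f₁ + f₂`, `f₁`, `f₂` respectively, then
`ρ_t = ρ¹_t ∘ ρ²_t = ρ²_t ∘ ρ¹_t`. -/
theorem flow_factorization (f₁ f₂ : ℝ → ℝ)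
    (hf₁ : ContDiff ℝ 1 f₁) (hf₂ : ContDiff ℝ 1 f₂)
    (hc₁ : HasCompactSupport f₁) (hc₂ : HasCompactSupport f₂)
    (hdisj : Disjoint (tsupport f₁) (tsupport f₂))
    (ρ ρ₁ ρ₂ : ℝ → ℝ → ℝ)
    (h0 : ∀ u, ρ 0 u = u) (h01 : ∀ u, ρ₁ 0 u = u) (h02 : ∀ u, ρ₂ 0 u = u)
    (hflow : ∀ t u, HasDerivAt (fun s => ρ s u) (f₁ (ρ t u) + f₂ (ρ t u)) t)
    (hflow1 : ∀ t u, HasDerivAt (fun s => ρ₁ s u) (f₁ (ρ₁ t u)) t)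
    (hflow2 : ∀ t u, HasDerivAt (fun s => ρ₂ s u) (f₂ (ρ₂ t u)) t) :
    ∀ t u : ℝ, ρ t u = ρ₁ t (ρ₂ t u) ∧ ρ t u = ρ₂ t (ρ₁ t u) := by
  obtain ⟨K₁, hK₁⟩ := hf₁.lipschitzWith_of_hasCompactSupport hc₁ one_ne_zero
  obtain ⟨K₂, hK₂⟩ := hf₂.lipschitzWith_of_hasCompactSupport hc₂ one_ne_zero
  have hzero (x : ℝ) : f₁ x = 0 ∨ f₂ x = 0 := by
    by_contra! h
    exact Set.disjoint_left.1 hdisj (subset_tsupport _ h.1) (subset_tsupport _ h.2)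
  intro t u
  rcases hzero u with hu | hu
  · exact (flow_eq_of_apply_eq_zero hK₂ hK₁ (fun x => (hzero x).symm) h0 h02 h01
      (fun t u => by simpa only [add_comm] using hflow t u) hflow2 hflow1 hu t).symm
  · exact flow_eq_of_apply_eq_zero hK₁ hK₂ hzero h0 h01 h02 hflow hflow1 hflow2 hu t
end

section
/- For C² functions φ : ℝ → ℝ with φ'(x) > 0 for all x and φ(x + 1) = φ(x) + 1 (lifts of orientation-preserving circle diffeomorphisms), define B(φ, ψ) = ∫_0^1 log(φ'(ψ(x))) · (ψ''(x)/ψ'(x)) dx. Then B satisfies the 2-cocycle identity: for all such φ, ψ, χ, B(ψ, χ) − B(φ ∘ ψ, χ) + B(φ, ψ ∘ χ) − B(φ, ψ) = 0. -/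
open Real intervalIntegral

/-- The Bott–Thurston 2-cocycle in terms of periodic lifts:
`B(φ, ψ) = ∫_0^1 log(φ'(ψ(x))) · (ψ''(x)/ψ'(x)) dx`. -/
noncomputable def bottCocycle (φ ψ : ℝ → ℝ) : ℝ :=
  ∫ x in (0:ℝ)..1, Real.log (deriv φ (ψ x)) * (deriv (deriv ψ) x / deriv ψ x)

theorem periodic_deriv_of_add_one {f : ℝ → ℝ} {c : ℝ} (h : ∀ x, f (x + 1) = f x + c) :
    Function.Periodic (deriv f) 1 := by
  intro x
  rw [← deriv_comp_add_const, funext h, deriv_add_const]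

theorem continuous_deriv_deriv {f : ℝ → ℝ} (hf : ContDiff ℝ 2 f) :
    Continuous (deriv (deriv f)) :=
  (contDiff_succ_iff_deriv (n := 1).1 hf).2.2.continuous_deriv le_rfl

theorem differentiable_deriv {f : ℝ → ℝ} (hf : ContDiff ℝ 2 f) :
    Differentiable ℝ (deriv f) :=
  (contDiff_succ_iff_deriv (n := 1).1 hf).2.2.differentiable one_ne_zero

theorem deriv_comp_eq {f g : ℝ → ℝ} (hf : Differentiable ℝ f) (hg : Differentiable ℝ g) :
    deriv (f ∘ g) = fun x => deriv f (g x) * deriv g x :=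
  funext fun x => deriv_comp x (hf _) (hg x)

/-- The nonlinearity `f''/f'` of a composition. -/
theorem deriv_deriv_comp_div {f g : ℝ → ℝ} (hf : ContDiff ℝ 2 f) (hg : ContDiff ℝ 2 g)
    (hf' : ∀ x, 0 < deriv f x) (hg' : ∀ x, 0 < deriv g x) (x : ℝ) :
    deriv (deriv (f ∘ g)) x / deriv (f ∘ g) x =
      deriv (deriv f) (g x) / deriv f (g x) * deriv g x + deriv (deriv g) x / deriv g x := by
  have hgd := hg.differentiable two_ne_zero
  have h : HasDerivAt (fun x => deriv f (g x) * deriv g x)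
      (deriv (deriv f) (g x) * deriv g x * deriv g x + deriv f (g x) * deriv (deriv g) x) x :=
    ((differentiable_deriv hf (g x)).hasDerivAt.comp x (hgd x).hasDerivAt).mul
      (differentiable_deriv hg x).hasDerivAt
  rw [deriv_comp_eq (hf.differentiable two_ne_zero) hgd, h.deriv]
  have := (hf' (g x)).ne'
  have := (hg' x).ne'
  field_simp

theorem continuous_bott_integrand {f g : ℝ → ℝ} (hf : ContDiff ℝ 2 f) (hg : ContDiff ℝ 2 g)
    (hf' : ∀ x, 0 < deriv f x) (hg' : ∀ x, 0 < deriv g x) :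
    Continuous fun x => Real.log (deriv f (g x)) * (deriv (deriv g) x / deriv g x) :=
  (((differentiable_deriv hf).continuous.comp hg.continuous).log fun x => (hf' (g x)).ne').mul
    ((continuous_deriv_deriv hg).div (differentiable_deriv hg).continuous fun x => (hg' x).ne')

theorem periodic_bott_integrand {f g : ℝ → ℝ} (hf : ∀ x, f (x + 1) = f x + 1)
    (hg : ∀ x, g (x + 1) = g x + 1) :
    Function.Periodic
      (fun x => Real.log (deriv f (g x)) * (deriv (deriv g) x / deriv g x)) 1 := by
  intro x
  have hg₂ : Function.Periodic (deriv (deriv g)) 1 :=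
    periodic_deriv_of_add_one (c := 0) fun y => by
      rw [periodic_deriv_of_add_one hg y, add_zero]
  simp only [hg x, periodic_deriv_of_add_one hf (g x), periodic_deriv_of_add_one hg x, hg₂ x]

/-- Change of variables by a lift of a circle diffeomorphism in the integral of a periodic
function. -/
theorem integral_comp_lift_mul_deriv {h χ : ℝ → ℝ} (hh : Continuous h)
    (hp : Function.Periodic h 1) (hχ : ContDiff ℝ 2 χ) (hχp : ∀ x, χ (x + 1) = χ x + 1) :
    ∫ x in (0 : ℝ)..1, h (χ x) * deriv χ x = ∫ x in (0 : ℝ)..1, h x := by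
  have h₁ : χ 1 = χ 0 + 1 := by simpa using hχp 0
  have h₂ := intervalIntegral.integral_comp_mul_deriv (a := 0) (b := 1) (f := χ) (g := h)
    (fun x _ => (hχ.differentiable two_ne_zero x).hasDerivAt)
    (differentiable_deriv hχ).continuous.continuousOn hh
  rw [h₁, hp.intervalIntegral_add_eq (χ 0) 0, zero_add] at h₂
  exact h₂

/-- The 2-cocycle identity for the Bott–Thurston cocycle on lifts of
orientation-preserving circle diffeomorphisms:
`B(ψ, χ) − B(φ∘ψ, χ) + B(φ, ψ∘χ) − B(φ, ψ) = 0`. -/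
theorem bottCocycle_identity (φ ψ χ : ℝ → ℝ)
    (hφ : ContDiff ℝ 2 φ) (hψ : ContDiff ℝ 2 ψ) (hχ : ContDiff ℝ 2 χ)
    (hφ' : ∀ x, 0 < deriv φ x) (hψ' : ∀ x, 0 < deriv ψ x) (hχ' : ∀ x, 0 < deriv χ x)
    (hφp : ∀ x, φ (x + 1) = φ x + 1) (hψp : ∀ x, ψ (x + 1) = ψ x + 1)
    (hχp : ∀ x, χ (x + 1) = χ x + 1) :
    bottCocycle ψ χ - bottCocycle (φ ∘ ψ) χ
      + bottCocycle φ (ψ ∘ χ) - bottCocycle φ ψ = 0 := by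
  have pos_comp {f g : ℝ → ℝ} (hf : ContDiff ℝ 2 f) (hg : ContDiff ℝ 2 g)
      (hf' : ∀ x, 0 < deriv f x) (hg' : ∀ x, 0 < deriv g x) (x : ℝ) : 0 < deriv (f ∘ g) x := by
    rw [deriv_comp_eq (hf.differentiable two_ne_zero) (hg.differentiable two_ne_zero)]
    exact mul_pos (hf' _) (hg' x)
  have c₁ := continuous_bott_integrand hψ hχ hψ' hχ'
  have c₂ := continuous_bott_integrand (hφ.comp hψ) hχ (pos_comp hφ hψ hφ' hψ') hχ'
  have c₃ := continuous_bott_integrand hφ (hψ.comp hχ) hφ' (pos_comp hψ hχ hψ' hχ')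
  rw [sub_eq_zero]
  unfold bottCocycle
  rw [← integral_comp_lift_mul_deriv (continuous_bott_integrand hφ hψ hφ' hψ')
      (periodic_bott_integrand hφp hψp) hχ hχp,
    ← intervalIntegral.integral_sub (c₁.intervalIntegrable 0 1) (c₂.intervalIntegrable 0 1),
    ← intervalIntegral.integral_add ((c₁.fun_sub c₂).intervalIntegrable 0 1)
      (c₃.intervalIntegrable 0 1)]
  refine intervalIntegral.integral_congr fun x _ => ?_
  rw [deriv_deriv_comp_div hψ hχ hψ' hχ',
    deriv_comp_eq (hφ.differentiable two_ne_zero) (hψ.differentiable two_ne_zero),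
    Real.log_mul (hφ' _).ne' (hψ' _).ne', Function.comp_apply]
  ring
end

section
/- Let K₁, K₂ be disjoint compact subsets of ℝ, and for i = 1, 2 let η_i : ℝ → ℝ be a C² bijection with η_i'(u) > 0 for all u and η_i(u) = u for all u ∉ K_i. Set η = η₁ ∘ η₂. Then for every u ∈ ℝ, (η''(u)/η'(u))² = (η₁''(u)/η₁'(u))² + (η₂''(u)/η₂'(u))², and consequently for every t ∈ ℝ, ∫_t^∞ (u − t)(η''(u)/η'(u))² du = ∫_t^∞ (u − t)(η₁''(u)/η₁'(u))² du + ∫_t^∞ (u − t)(η₂''(u)/η₂'(u))² du. -/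
open Real MeasureTheory

open Filter Topology

theorem deriv_deriv_div_deriv_congr {f g : ℝ → ℝ} {u : ℝ} (h : f =ᶠ[𝓝 u] g) :
    deriv (deriv f) u / deriv f u = deriv (deriv g) u / deriv g u := by
  rw [h.deriv.deriv_eq, h.deriv_eq]

theorem eventuallyEq_id_of_notMem {K : Set ℝ} (hK : IsCompact K) {η : ℝ → ℝ}
    (hid : ∀ u, u ∉ K → η u = u) {u : ℝ} (hu : u ∉ K) : η =ᶠ[𝓝 u] id := by
  filter_upwards [hK.isClosed.isOpen_compl.mem_nhds hu] with v hv using hid v hv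

theorem deriv_deriv_div_deriv_eq_zero {K : Set ℝ} (hK : IsCompact K) {η : ℝ → ℝ}
    (hid : ∀ u, u ∉ K → η u = u) {u : ℝ} (hu : u ∉ K) :
    deriv (deriv η) u / deriv η u = 0 := by
  rw [deriv_deriv_div_deriv_congr (eventuallyEq_id_of_notMem hK hid hu)]
  simp

theorem mem_of_injective_of_eq_self {α : Type*} {K : Set α} {η : α → α}
    (hη : Function.Injective η) (hid : ∀ u, u ∉ K → η u = u) {u : α} (hu : u ∈ K) :
    η u ∈ K := by
  by_contra h
  exact h ((hη (hid _ h)).symm ▸ hu)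

theorem integrable_sub_mul_sq_deriv_deriv_div_deriv {K : Set ℝ} (hK : IsCompact K)
    {η : ℝ → ℝ} (hc : ContDiff ℝ 2 η) (hp : ∀ u, 0 < deriv η u)
    (hid : ∀ u, u ∉ K → η u = u) (t : ℝ) :
    Integrable fun u => (u - t) * (deriv (deriv η) u / deriv η u) ^ 2 := by
  have h₁ : ContDiff ℝ 1 (deriv η) := ContDiff.deriv' hc
  refine Continuous.integrable_of_hasCompactSupport ?_ (HasCompactSupport.intro hK ?_)
  · exact (continuous_id.sub continuous_const).mul
      (((h₁.continuous_deriv le_rfl).div h₁.continuous fun u => (hp u).ne').pow 2)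
  · intro u hu
    simp [deriv_deriv_div_deriv_eq_zero hK hid hu]

/-- Extensivity of the half-line relative entropy: if `η₁, η₂` are increasing C²
diffeomorphisms of `ℝ` equal to the identity outside disjoint compact sets
`K₁, K₂`, and `η = η₁ ∘ η₂`, then `(η''/η')² = (η₁''/η₁')² + (η₂''/η₂')²`
pointwise, and the entropy integrals add up. -/
theorem entropy_extensivity (K₁ K₂ : Set ℝ)
    (hK₁ : IsCompact K₁) (hK₂ : IsCompact K₂) (hdisj : Disjoint K₁ K₂)
    (η₁ η₂ : ℝ → ℝ)
    (hb₁ : Function.Bijective η₁) (hb₂ : Function.Bijective η₂)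
    (hc₁ : ContDiff ℝ 2 η₁) (hc₂ : ContDiff ℝ 2 η₂)
    (hp₁ : ∀ u, 0 < deriv η₁ u) (hp₂ : ∀ u, 0 < deriv η₂ u)
    (hid₁ : ∀ u, u ∉ K₁ → η₁ u = u) (hid₂ : ∀ u, u ∉ K₂ → η₂ u = u) :
    (∀ u : ℝ, (deriv (deriv (η₁ ∘ η₂)) u / deriv (η₁ ∘ η₂) u) ^ 2
        = (deriv (deriv η₁) u / deriv η₁ u) ^ 2
          + (deriv (deriv η₂) u / deriv η₂ u) ^ 2)
    ∧ ∀ t : ℝ,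
        (∫ u in Set.Ioi t,
            (u - t) * (deriv (deriv (η₁ ∘ η₂)) u / deriv (η₁ ∘ η₂) u) ^ 2)
        = (∫ u in Set.Ioi t, (u - t) * (deriv (deriv η₁) u / deriv η₁ u) ^ 2)
          + ∫ u in Set.Ioi t, (u - t) * (deriv (deriv η₂) u / deriv η₂ u) ^ 2 := by
  have key : ∀ u : ℝ, (deriv (deriv (η₁ ∘ η₂)) u / deriv (η₁ ∘ η₂) u) ^ 2
      = (deriv (deriv η₁) u / deriv η₁ u) ^ 2 + (deriv (deriv η₂) u / deriv η₂ u) ^ 2 := by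
    intro u
    by_cases hu : u ∈ K₂
    · have hη : η₁ ∘ η₂ =ᶠ[𝓝 u] η₂ :=
        (eventuallyEq_id_of_notMem hK₁ hid₁ (hdisj.notMem_of_mem_right
          (mem_of_injective_of_eq_self hb₂.injective hid₂ hu))).comp_tendsto
          hc₂.continuous.continuousAt
      rw [deriv_deriv_div_deriv_congr hη,
        deriv_deriv_div_deriv_eq_zero hK₁ hid₁ (hdisj.notMem_of_mem_right hu)]
      ring
    · have hη : η₁ ∘ η₂ =ᶠ[𝓝 u] η₁ := (eventuallyEq_id_of_notMem hK₂ hid₂ hu).fun_comp η₁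
      rw [deriv_deriv_div_deriv_congr hη, deriv_deriv_div_deriv_eq_zero hK₂ hid₂ hu]
      ring
  refine ⟨key, fun t => ?_⟩
  simp_rw [key, mul_add]
  exact integral_add
    (integrable_sub_mul_sq_deriv_deriv_div_deriv hK₁ hc₁ hp₁ hid₁ t).integrableOn
    (integrable_sub_mul_sq_deriv_deriv_div_deriv hK₂ hc₂ hp₂ hid₂ t).integrableOn
end
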